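/- Let X be a proper metric space and γ a consistent constant-speed bicombing on X for which there is a continuous f : [0,∞) → [0,∞) with f(0) = 0 and |l(γ_{x,y}) − l(γ_{x',y'})| ≤ f(d(x,x') + d(y,y')) for all x,x',y,y'. Then the map FS(X,γ) → lim_{n∈ℕ} A(X,γ,[−n,n]), w ↦ (res_{[−n,n]}(w))_{n∈ℕ}, is a homeomorphism onto the inverse limit of the inverse system whose spaces are A(X,γ,[−n,n]) and whose bonding maps are the restrictions res_{[−n,n]} : A(X,γ,[−(n+1),n+1]) → A(X,γ,[−n,n]). -/

import Mathlib

open MeasureTheory Set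

namespace FJ

/-- A constant-speed bicombing on a metric space `X`: a continuous map
`γ : X × X × [0,1] → X` such that each `γ_{x,y} := γ(x,y,·)` is a rectifiable path from `x`
to `y` of constant speed equal to its length `len x y`. -/
structure ConstSpeedBicombing (X : Type*) [MetricSpace X] where
  toFun : X → X → ℝ → X
  len : X → X → ℝ
  len_nonneg : ∀ x y, 0 ≤ len x y
  continuousOn : ContinuousOn (fun p : X × X × ℝ => toFun p.1 p.2.1 p.2.2)
      (Set.univ ×ˢ Set.univ ×ˢ Set.Icc (0:ℝ) 1)
  source : ∀ x y, toFun x y 0 = x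
  target : ∀ x y, toFun x y 1 = y
  speed : ∀ (x y : X) (s t : ℝ), 0 ≤ s → s ≤ t → t ≤ 1 →
      eVariationOn (toFun x y) (Set.Icc s t) = ENNReal.ofReal (len x y * (t - s))

/-- The trail `c_{x,y} : ℝ → X` associated to a bicombing: constant `x` on `(-∞,0]`,
the path `γ_{x,y}` parametrised by arclength on `[0, len x y]`, constant `y` on
`[len x y, ∞)`. -/
noncomputable def trail {X : Type*} [MetricSpace X] (B : ConstSpeedBicombing X)
    (x y : X) : ℝ → X :=
  fun t => if t ≤ 0 then x else if t < B.len x y then B.toFun x y (t / B.len x y) else y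

/-- The shift `Φ_τ(f) = f(· + τ)`. -/
def timeShift {X : Type*} (τ : ℝ) (f : ℝ → X) : ℝ → X := fun t => f (t + τ)

/-- The metric `D` on `Lip₁(X)`: `D(f,g) = ∫_ℝ d(f t, g t) / (2 e^{|t|}) dt`. -/
noncomputable def lipDist {X : Type*} [MetricSpace X] (f g : ℝ → X) : ℝ :=
  ∫ t : ℝ, dist (f t) (g t) / (2 * Real.exp |t|)

/-- `A(X,γ) = {Φ_τ c_{x,y} | τ ∈ ℝ, x, y ∈ X}`, as a subset of `C(ℝ, X)` (whose
compact-open topology induces on `Lip₁(X)` the topology of the metric `D`). -/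
def ASet {X : Type*} [MetricSpace X] (B : ConstSpeedBicombing X) : Set C(ℝ, X) :=
  {w | ∃ (x y : X) (τ : ℝ), ∀ s, w s = trail B x y (s + τ)}

/-- The flow space `FS(X,γ)`, the closure of `A(X,γ)`. -/
def FSSet {X : Type*} [MetricSpace X] (B : ConstSpeedBicombing X) : Set C(ℝ, X) :=
  closure (ASet B)

/-- The restriction `res_{[a,b]}(w)`: equal to `w a` on `(-∞,a]`, to `w` on `[a,b]`,
and to `w b` on `[b,∞)`. -/
noncomputable def trailRes {X : Type*} (a b : ℝ) (w : ℝ → X) : ℝ → X :=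
  fun t => if t ≤ a then w a else if t ≤ b then w t else w b

/-- `A(X,γ,[a,b]) = A(X,γ) ∩ Lip₁(X,[a,b])`: the elements of `A(X,γ)` which are constant
on `(-∞,a]` and on `[b,∞)`. -/
def AIntSet {X : Type*} [MetricSpace X] (B : ConstSpeedBicombing X) (a b : ℝ) :
    Set C(ℝ, X) :=
  {w | w ∈ ASet B ∧ (∀ s, s ≤ a → w s = w a) ∧ (∀ s, b ≤ s → w s = w b)}

/-- A bicombing is consistent if the chosen paths behave well under restriction. -/
def BicombingConsistent {X : Type*} [MetricSpace X] (B : ConstSpeedBicombing X) : Prop :=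
  ∀ (x y : X) (s s' t : ℝ), 0 ≤ s → s < s' → s' ≤ 1 → s ≤ t → t ≤ s' →
    B.toFun x y t = B.toFun (B.toFun x y s) (B.toFun x y s') ((t - s) / (s' - s))

/-- A bicombing is `A`-convex if `d(γ_{x,y}(t), γ_{x',y'}(t)) ≤ A(t, d(x,x'), d(y,y'))`. -/
def BicombingAConvex {X : Type*} [MetricSpace X] (B : ConstSpeedBicombing X)
    (A : ℝ → ℝ → ℝ → ℝ) : Prop :=
  ∀ (x x' y y' : X) (t : ℝ), 0 ≤ t → t ≤ 1 →
    dist (B.toFun x y t) (B.toFun x' y' t) ≤ A t (dist x x') (dist y y')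

/-- The conditions on the comparison function `A` of an `A`-convex bicombing:
`A : [0,1] × [0,∞) × [0,∞) → [0,∞)` is continuous with `A(1,s,0) = A(0,0,s) = 0`. -/
def ConvexityFun (A : ℝ → ℝ → ℝ → ℝ) : Prop :=
  ContinuousOn (fun p : ℝ × ℝ × ℝ => A p.1 p.2.1 p.2.2)
      (Set.Icc (0:ℝ) 1 ×ˢ Set.Ici (0:ℝ) ×ˢ Set.Ici (0:ℝ)) ∧
  (∀ t s s', 0 ≤ t → t ≤ 1 → 0 ≤ s → 0 ≤ s' → 0 ≤ A t s s') ∧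
  (∀ s, 0 ≤ s → A 1 s 0 = 0) ∧ (∀ s, 0 ≤ s → A 0 0 s = 0)

/-- The monotonicity conditions on `A`: monotonically increasing in the second and third
arguments and, in the first argument, monotonically increasing on `[0,1/3]` and
monotonically decreasing on `[2/3,1]`. -/
def MonotoneConvexityFun (A : ℝ → ℝ → ℝ → ℝ) : Prop :=
  (∀ t s₁ s₂ s', 0 ≤ t → t ≤ 1 → 0 ≤ s₁ → s₁ ≤ s₂ → 0 ≤ s' → A t s₁ s' ≤ A t s₂ s') ∧
  (∀ t s s₁ s₂, 0 ≤ t → t ≤ 1 → 0 ≤ s → 0 ≤ s₁ → s₁ ≤ s₂ → A t s s₁ ≤ A t s s₂) ∧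
  (∀ t₁ t₂ s s', 0 ≤ t₁ → t₁ ≤ t₂ → t₂ ≤ 1/3 → 0 ≤ s → 0 ≤ s' → A t₁ s s' ≤ A t₂ s s') ∧
  (∀ t₁ t₂ s s', 2/3 ≤ t₁ → t₁ ≤ t₂ → t₂ ≤ 1 → 0 ≤ s → 0 ≤ s' → A t₂ s s' ≤ A t₁ s s')

namespace ConstSpeedBicombing

variable {X : Type*} [MetricSpace X] (B : ConstSpeedBicombing X)

theorem dist_toFun_le (x y : X) {s t : ℝ} (hs : 0 ≤ s) (hst : s ≤ t) (ht : t ≤ 1) :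
    dist (B.toFun x y s) (B.toFun x y t) ≤ B.len x y * (t - s) := by
  have h := eVariationOn.edist_le (B.toFun x y) (left_mem_Icc.2 hst) (right_mem_Icc.2 hst)
  rw [B.speed x y s t hs hst ht, edist_dist] at h
  exact (ENNReal.ofReal_le_ofReal_iff
    (mul_nonneg (B.len_nonneg x y) (sub_nonneg.2 hst))).1 h

theorem dist_le_len (x y : X) : dist x y ≤ B.len x y := by
  simpa [B.source, B.target] using B.dist_toFun_le x y le_rfl zero_le_one le_rfl

theorem eq_of_len_eq_zero {x y : X} (h : B.len x y = 0) : x = y :=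
  dist_le_zero.1 (h ▸ B.dist_le_len x y)

theorem trail_eq (x y : X) (t : ℝ) :
    trail B x y t = B.toFun x y (max 0 (min t (B.len x y)) / B.len x y) := by
  have hL := B.len_nonneg x y
  unfold trail
  split_ifs with h₁ h₂
  · rw [max_eq_left ((min_le_left _ _).trans h₁), zero_div, B.source]
  · rw [min_eq_left h₂.le, max_eq_right (not_le.1 h₁).le]
  · rw [min_eq_right (not_lt.1 h₂), max_eq_right hL]
    rcases hL.eq_or_lt with h | h
    · rw [← h, div_zero, B.source, B.eq_of_len_eq_zero h.symm]
    · rw [div_self h.ne', B.target]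

theorem trail_of_nonpos (x y : X) {t : ℝ} (ht : t ≤ 0) : trail B x y t = x :=
  if_pos ht

theorem trail_of_len_le (x y : X) {t : ℝ} (ht : B.len x y ≤ t) : trail B x y t = y := by
  unfold trail
  split_ifs with h₁ h₂
  · exact B.eq_of_len_eq_zero (le_antisymm (ht.trans h₁) (B.len_nonneg x y))
  · exact absurd ht (not_le.2 h₂)
  · rfl

theorem clamp_div_mem_Icc {L : ℝ} (hL : 0 ≤ L) (t : ℝ) :
    max 0 (min t L) / L ∈ Icc (0 : ℝ) 1 :=
  ⟨div_nonneg (le_max_left _ _) hL,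
    div_le_one_of_le₀ (max_le hL (min_le_right _ _)) hL⟩

theorem dist_trail_le (x y : X) (t : ℝ) : dist x (trail B x y t) ≤ B.len x y := by
  have h := clamp_div_mem_Icc (B.len_nonneg x y) t
  rw [trail_eq]
  have := B.dist_toFun_le x y le_rfl h.1 h.2
  rw [B.source, sub_zero] at this
  exact this.trans (mul_le_of_le_one_right (B.len_nonneg x y) h.2)

variable {B}

theorem continuous_trail (hB : Continuous fun p : X × X => B.len p.1 p.2) :
    Continuous fun p : X × X × ℝ => trail B p.1 p.2.1 p.2.2 := by
  have hl : Continuous fun p : X × X × ℝ => B.len p.1 p.2.1 :=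
    hB.comp (continuous_fst.prodMk (continuous_fst.comp continuous_snd))
  refine continuous_iff_continuousAt.2 fun p => ?_
  rcases (B.len_nonneg p.1 p.2.1).eq_or_lt with h | h
  · have hlim : Filter.Tendsto (fun q : X × X × ℝ => dist q.1 p.1 + B.len q.1 q.2.1)
        (nhds p) (nhds 0) := by
      have hc : Continuous fun q : X × X × ℝ => dist q.1 p.1 + B.len q.1 q.2.1 := by fun_prop
      simpa [← h] using hc.tendsto p
    have hp : trail B p.1 p.2.1 p.2.2 = p.1 :=
      (dist_le_zero.1 (h ▸ B.dist_trail_le p.1 p.2.1 p.2.2)).symm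
    refine tendsto_iff_dist_tendsto_zero.2 ?_
    refine squeeze_zero (fun _ => dist_nonneg) (fun q => ?_) hlim
    dsimp only
    rw [hp]
    calc _ ≤ dist (trail B q.1 q.2.1 q.2.2) q.1 + dist q.1 p.1 := dist_triangle _ _ _
      _ ≤ _ := by
        rw [dist_comm _ q.1, add_comm]
        gcongr
        exact B.dist_trail_le _ _ _
  · simp only [trail_eq]
    have hmem : ∀ q : X × X × ℝ, (q.1, q.2.1,
        max 0 (min q.2.2 (B.len q.1 q.2.1)) / B.len q.1 q.2.1) ∈
          (univ ×ˢ univ ×ˢ Icc (0 : ℝ) 1 : Set (X × X × ℝ)) := fun q =>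
      ⟨trivial, trivial, clamp_div_mem_Icc (B.len_nonneg _ _) _⟩
    have hg : ContinuousAt (fun q : X × X × ℝ => (q.1, q.2.1,
        max 0 (min q.2.2 (B.len q.1 q.2.1)) / B.len q.1 q.2.1)) p := by
      refine continuousAt_fst.prodMk ((by fun_prop : ContinuousAt _ _).prodMk ?_)
      refine ContinuousAt.div ?_ hl.continuousAt h.ne'
      exact (by fun_prop : Continuous fun q : X × X × ℝ =>
        max 0 (min q.2.2 (B.len q.1 q.2.1))).continuousAt
    exact (B.continuousOn _ (hmem p)).tendsto.comp
      (tendsto_nhdsWithin_iff.2 ⟨hg, Filter.Eventually.of_forall hmem⟩)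

theorem continuous_len_of_control {f : ℝ → ℝ} (hfc : ContinuousOn f (Ici 0)) (hf0 : f 0 = 0)
    (hlen : ∀ x x' y y' : X, |B.len x y - B.len x' y'| ≤ f (dist x x' + dist y y')) :
    Continuous fun p : X × X => B.len p.1 p.2 := by
  refine continuous_iff_continuousAt.2 fun p => ?_
  refine tendsto_iff_dist_tendsto_zero.2 ?_
  refine squeeze_zero (fun _ => dist_nonneg)
    (fun q => hlen q.1 p.1 q.2 p.2) ?_
  have hd : Filter.Tendsto (fun q : X × X => dist q.1 p.1 + dist q.2 p.2) (nhds p)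
      (nhdsWithin 0 (Ici 0)) := by
    refine tendsto_nhdsWithin_iff.2 ⟨?_, Filter.Eventually.of_forall fun q => ?_⟩
    · have hc : Continuous fun q : X × X => dist q.1 p.1 + dist q.2 p.2 := by fun_prop
      simpa using hc.tendsto p
    · exact add_nonneg dist_nonneg dist_nonneg
  have h0 := (hfc 0 self_mem_Ici).tendsto.comp hd
  rwa [hf0] at h0

end ConstSpeedBicombing

namespace BicombingConsistent

variable {X : Type*} [MetricSpace X] {B : ConstSpeedBicombing X}

theorem len_toFun (hcons : BicombingConsistent B) (x y : X) {s t : ℝ}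
    (hs : 0 ≤ s) (hst : s < t) (ht : t ≤ 1) :
    B.len (B.toFun x y s) (B.toFun x y t) = B.len x y * (t - s) := by
  have hd : 0 < t - s := sub_pos.2 hst
  have hmono : MonotoneOn (fun r => (r - s) / (t - s)) (Icc s t) := fun a _ b _ hab => by
    dsimp only; gcongr
  have himg : (fun r => (r - s) / (t - s)) '' Icc s t = Icc 0 1 := by
    ext r
    constructor
    · rintro ⟨a, ⟨h₁, h₂⟩, rfl⟩
      exact ⟨div_nonneg (sub_nonneg.2 h₁) hd.le, (div_le_one hd).2 (by linarith)⟩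
    · rintro ⟨h₁, h₂⟩
      refine ⟨s + r * (t - s), ⟨by nlinarith, by nlinarith⟩, ?_⟩
      dsimp only
      field_simp
      ring
  have h₁ := eVariationOn.comp_eq_of_monotoneOn
    (B.toFun (B.toFun x y s) (B.toFun x y t)) _ hmono
  rw [himg, B.speed _ _ 0 1 le_rfl zero_le_one le_rfl, ← eVariationOn.eq_of_eqOn
    (f := B.toFun x y) (f' := B.toFun (B.toFun x y s) (B.toFun x y t) ∘ fun r => (r - s) / (t - s))
    (fun r hr => hcons x y s t r hs hst ht hr.1 hr.2),
    B.speed x y s t hs hst.le ht] at h₁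
  have := (ENNReal.ofReal_eq_ofReal_iff (mul_nonneg (B.len_nonneg _ _) hd.le)
    (mul_nonneg (B.len_nonneg _ _) (by norm_num))).1 h₁
  linarith

theorem len_self (hcons : BicombingConsistent B)
    (hB : Continuous fun p : X × X => B.len p.1 p.2) (x : X) : B.len x x = 0 := by
  have hlim : Filter.Tendsto (fun t : ℝ => B.len x x * t) (nhdsWithin 0 (Ioi 0)) (nhds 0) := by
    have hc : Continuous fun t : ℝ => B.len x x * t := by fun_prop
    simpa using (hc.tendsto 0).mono_left nhdsWithin_le_nhds
  have hev : ∀ᶠ t in nhdsWithin (0 : ℝ) (Ioi 0), t ∈ Ioc (0 : ℝ) 1 :=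
    Ioc_mem_nhdsGT zero_lt_one
  have hpath : Filter.Tendsto (B.toFun x x) (nhdsWithin 0 (Ioi 0)) (nhds x) := by
    refine tendsto_iff_dist_tendsto_zero.2 (squeeze_zero' (.of_forall fun _ => dist_nonneg) ?_ hlim)
    filter_upwards [hev] with t ht
    simpa [B.source, dist_comm] using B.dist_toFun_le x x le_rfl ht.1.le ht.2
  have hlen : Filter.Tendsto (fun t => B.len x (B.toFun x x t)) (nhdsWithin 0 (Ioi 0))
      (nhds (B.len x x)) :=
    (hB.tendsto (x, x)).comp (tendsto_const_nhds.prodMk_nhds hpath)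
  refine tendsto_nhds_unique (hlen.congr' ?_) hlim
  filter_upwards [hev] with t ht
  simpa [B.source] using hcons.len_toFun x x le_rfl ht.1 ht.2

/-- The part of a trail between the parameters `a` and `b` is again a trail, whose nonconstant
part lies between `a` and `b`. -/
theorem exists_trail_clamp_eq (hcons : BicombingConsistent B)
    (hself : ∀ x, B.len x x = 0) (x y : X) {a b : ℝ} (hab : a ≤ b) :
    ∃ σ ∈ Icc a b, σ + B.len (trail B x y a) (trail B x y b) ≤ b ∧
      ∀ s, trail B x y (max a (min s b)) =
        trail B (trail B x y a) (trail B x y b) (s - σ) := by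
  set L := B.len x y with hLdef
  set p := max 0 (min a L) with hp
  set q := max 0 (min b L) with hq
  have hL : 0 ≤ L := B.len_nonneg x y
  have hp0 : 0 ≤ p := le_max_left _ _
  have hqL : q ≤ L := max_le hL (min_le_right _ _)
  have hpq : p ≤ q := max_le_max_left _ (min_le_min_right _ hab)
  have hx : trail B x y a = B.toFun x y (p / L) := B.trail_eq x y a
  have hy : trail B x y b = B.toFun x y (q / L) := B.trail_eq x y b
  rcases hpq.eq_or_lt with h | h
  · have hxy : trail B x y b = trail B x y a := by rw [hx, hy, h]
    refine ⟨a, left_mem_Icc.2 hab, by simpa [hxy, hself] using hab, fun s => ?_⟩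
    have hr : trail B (trail B x y a) (trail B x y b) (s - a) = trail B x y a :=
      (dist_le_zero.1 ((B.dist_trail_le _ _ _).trans_eq (by rw [hxy, hself]))).symm
    have hc : max 0 (min (max a (min s b)) L) = p := by
      refine le_antisymm ?_ (max_le_max_left _ (min_le_min_right _ (le_max_left _ _)))
      rw [h]
      exact max_le_max_left _ (min_le_min_right _ (max_le hab (min_le_right _ _)))
    rw [hr, hx, B.trail_eq, ← hLdef, hc]
  · have hLpos : 0 < L := by linarith
    have hpL : p < L := h.trans_le hqL
    have hlt : p / L < q / L := div_lt_div_of_pos_right h hLpos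
    have hp' : 0 ≤ p / L := div_nonneg hp0 hL
    have hq' : q / L ≤ 1 := (div_le_one hLpos).2 hqL
    have hlen : B.len (trail B x y a) (trail B x y b) = q - p := by
      rw [hx, hy, hcons.len_toFun x y hp' hlt hq', ← hLdef]
      field_simp
    have hpa : a ≤ p := by grind
    have hqb : q ≤ b := by grind
    refine ⟨p, ⟨hpa, (h.trans_le hqb).le⟩, by linarith, fun s => ?_⟩
    have hc : max 0 (min (max a (min s b)) L) = p + max 0 (min (s - p) (q - p)) := by
      grind
    set r := max 0 (min (s - p) (q - p)) with hr
    have hr0 : 0 ≤ r := le_max_left _ _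
    have hrq : r ≤ q - p := max_le (by linarith) (min_le_right _ _)
    rw [B.trail_eq (trail B x y a), hlen, ← hr, B.trail_eq x y (max a _), ← hLdef, hc, hx, hy]
    rw [hcons x y (p / L) (q / L) ((p + r) / L) hp' hlt hq' (by gcongr; linarith)
      (by gcongr; linarith)]
    congr 1
    have : q - p ≠ 0 := by linarith
    field_simp
    ring

end BicombingConsistent

theorem trailRes_eq_clamp {X : Type*} {a b : ℝ} (hab : a ≤ b) (w : ℝ → X) (t : ℝ) :
    trailRes a b w t = w (max a (min t b)) := by
  unfold trailRes
  split_ifs with h₁ h₂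
  · rw [max_eq_left ((min_le_left _ _).trans h₁)]
  · rw [min_eq_left h₂, max_eq_right (not_le.1 h₁).le]
  · rw [min_eq_right (not_le.1 h₂).le, max_eq_right hab]

/-- The clamping map `t ↦ max a (min t b)`. -/
def clamp (a b : ℝ) : C(ℝ, ℝ) := ⟨fun t => max a (min t b), by fun_prop⟩

section ClosedTrails

variable {X : Type*} [MetricSpace X] {B : ConstSpeedBicombing X}

/-- The trails whose nonconstant part lies between the parameters `a` and `b`. -/
def trailsBetween (B : ConstSpeedBicombing X) (a b : ℝ) : Set C(ℝ, X) :=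
  {w | ∃ σ ∈ Icc a b, σ + B.len (w a) (w b) ≤ b ∧ ∀ s, w s = trail B (w a) (w b) (s - σ)}

theorem isClosed_trailsBetween (hB : Continuous fun p : X × X => B.len p.1 p.2) (a b : ℝ) :
    IsClosed (trailsBetween B a b) := by
  have hT := ConstSpeedBicombing.continuous_trail hB
  have hS : IsClosed {p : C(ℝ, X) × Icc a b | (p.2 : ℝ) + B.len (p.1 a) (p.1 b) ≤ b ∧
      ∀ s, p.1 s = trail B (p.1 a) (p.1 b) (s - p.2)} := by
    have hev : ∀ r : ℝ, Continuous fun p : C(ℝ, X) × Icc a b => p.1 r := fun r =>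
      (continuous_eval_const r).comp continuous_fst
    have hσ : Continuous fun p : C(ℝ, X) × Icc a b => (p.2 : ℝ) :=
      continuous_subtype_val.comp continuous_snd
    refine IsClosed.inter (isClosed_le (hσ.add (hB.comp ((hev a).prodMk (hev b))))
      continuous_const) ?_
    have : {p : C(ℝ, X) × Icc a b | ∀ s, p.1 s = trail B (p.1 a) (p.1 b) (s - p.2)} =
        ⋂ s, {p | p.1 s = trail B (p.1 a) (p.1 b) (s - p.2)} := by ext; simp
    change IsClosed {p : C(ℝ, X) × Icc a b | ∀ s, p.1 s = trail B (p.1 a) (p.1 b) (s - p.2)}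
    rw [this]
    exact isClosed_iInter fun s => isClosed_eq (hev s)
      (hT.comp ((hev a).prodMk ((hev b).prodMk (continuous_const.sub hσ))))
  convert! isClosedMap_fst_of_compactSpace _ hS using 1
  ext w
  simp only [trailsBetween, mem_ofPred_eq, mem_image, Prod.exists, Subtype.exists]
  constructor
  · rintro ⟨σ, hσ, h⟩
    exact ⟨w, σ, hσ, h, rfl⟩
  · rintro ⟨_, σ, hσ, h, rfl⟩
    exact ⟨σ, hσ, h⟩

theorem trailsBetween_subset_AIntSet (a b : ℝ) : trailsBetween B a b ⊆ AIntSet B a b := by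
  rintro w ⟨σ, hσ, hb, hw⟩
  refine ⟨⟨w a, w b, -σ, hw⟩, fun s hs => ?_, fun s hs => ?_⟩
  · rw [hw s, B.trail_of_nonpos _ _ (by linarith [hσ.1])]
  · rw [hw s, B.trail_of_len_le _ _ (by linarith)]

theorem comp_clamp_mem_AIntSet (hcons : BicombingConsistent B)
    (hB : Continuous fun p : X × X => B.len p.1 p.2) {a b : ℝ} (hab : a ≤ b) {w : C(ℝ, X)}
    (hw : w ∈ FSSet B) : w.comp (clamp a b) ∈ AIntSet B a b := by
  refine trailsBetween_subset_AIntSet a b ((isClosed_trailsBetween hB a b).closure_subset ?_)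
  refine map_mem_closure (f := fun v : C(ℝ, X) => v.comp (clamp a b))
    (ContinuousMap.continuous_precomp _) hw ?_
  rintro v ⟨x, y, τ, hv⟩
  obtain ⟨σ, hσ, hle, h⟩ := hcons.exists_trail_clamp_eq (hcons.len_self hB) x y
    (add_le_add_left hab τ)
  have ha : v.comp (clamp a b) a = trail B x y (a + τ) := by simp [clamp, hv, hab]
  have hb : v.comp (clamp a b) b = trail B x y (b + τ) := by simp [clamp, hv, hab]
  refine ⟨σ - τ, ⟨by linarith [hσ.1], by linarith [hσ.2]⟩, ?_, fun s => ?_⟩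
  · rw [ha, hb]
    linarith
  · rw [ha, hb]
    have := h (s + τ)
    rw [min_add_add_right, max_add_add_right] at this
    simp only [ContinuousMap.comp_apply, clamp, ContinuousMap.coe_mk, hv, this]
    congr 1
    ring

end ClosedTrails

section Glue

variable {X : Type*} [TopologicalSpace X]

/-- A sequence of maps each of which is the restriction of the next one. -/
def ResCompatible (u : ℕ → C(ℝ, X)) : Prop :=
  ∀ (n : ℕ) (s : ℝ), u n s = trailRes (-(n : ℝ)) (n : ℝ) (⇑(u (n + 1))) s

theorem neg_natCast_le (n : ℕ) : -(n : ℝ) ≤ n :=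
  neg_le_self n.cast_nonneg

theorem ResCompatible.eq_of_le {u : ℕ → C(ℝ, X)} (hu : ResCompatible u) {m n : ℕ}
    (hmn : m ≤ n) (s : ℝ) : u m s = u n (clamp (-(m : ℝ)) m s) := by
  induction n, hmn using Nat.le_induction with
  | base => rw [hu m, hu m]; simp only [trailRes_eq_clamp (neg_natCast_le m), clamp]; simp
  | succ n hmn ih =>
    have h : (m : ℝ) ≤ n := by exact_mod_cast hmn
    rw [ih, hu n, trailRes_eq_clamp (neg_natCast_le n)]
    congr 1
    simp only [clamp, ContinuousMap.coe_mk]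
    have := neg_natCast_le m
    rw [min_eq_left ((max_le this (min_le_right _ _)).trans h),
      max_eq_right ((neg_le_neg h).trans (le_max_left _ _))]

/-- The map which agrees with `u n` on `[-n, n]`, for a compatible sequence `u`. -/
noncomputable def glueFun (u : ℕ → C(ℝ, X)) (s : ℝ) : X := u ⌈|s|⌉₊ s

theorem clamp_of_abs_le {a s : ℝ} (hs : |s| ≤ a) : clamp (-a) a s = s := by
  rw [abs_le] at hs
  simp [clamp, hs.1, hs.2]

theorem ResCompatible.glueFun_eq {u : ℕ → C(ℝ, X)} (hu : ResCompatible u) {n : ℕ} {s : ℝ}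
    (hs : |s| ≤ n) : glueFun u s = u n s := by
  rw [glueFun, hu.eq_of_le (Nat.ceil_le.2 hs), clamp_of_abs_le (Nat.le_ceil _)]

theorem continuous_glueFun_uncurry :
    Continuous fun p : {u : ℕ → C(ℝ, X) // ResCompatible u} × ℝ => glueFun p.1.1 p.2 := by
  refine continuous_iff_continuousAt.2 fun p => ?_
  obtain ⟨n, hn⟩ := exists_nat_gt |p.2|
  have hc : Continuous fun q : {u : ℕ → C(ℝ, X) // ResCompatible u} × ℝ => q.1.1 n q.2 :=
    continuous_eval.comp ((((continuous_apply n).comp continuous_subtype_val).comp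
      continuous_fst).prodMk continuous_snd)
  refine hc.continuousAt.congr ?_
  have ho : IsOpen {q : {u : ℕ → C(ℝ, X) // ResCompatible u} × ℝ | |q.2| < n} :=
    isOpen_lt (by fun_prop) continuous_const
  filter_upwards [ho.mem_nhds hn] with q hq
  exact (q.1.2.glueFun_eq (le_of_lt hq)).symm

/-- The continuous map which agrees with `u n` on `[-n, n]`. -/
noncomputable def glue (u : {u : ℕ → C(ℝ, X) // ResCompatible u}) : C(ℝ, X) :=
  ⟨glueFun u.1, continuous_glueFun_uncurry.comp (continuous_const.prodMk continuous_id)⟩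

theorem continuous_glue :
    Continuous (glue : {u : ℕ → C(ℝ, X) // ResCompatible u} → C(ℝ, X)) :=
  ContinuousMap.continuous_of_continuous_uncurry _ continuous_glueFun_uncurry

theorem tendsto_glue (u : {u : ℕ → C(ℝ, X) // ResCompatible u}) :
    Filter.Tendsto u.1 Filter.atTop (nhds (glue u)) := by
  refine ContinuousMap.tendsto_nhds_compactOpen.2 fun K hK U _ hKU => ?_
  obtain ⟨r, hr⟩ := hK.isBounded.exists_norm_le
  filter_upwards [Filter.eventually_ge_atTop ⌈r⌉₊] with n hn s hs
  have hsn : |s| ≤ n := (hr s hs).trans (Nat.ceil_le.1 hn)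
  rw [← u.2.glueFun_eq hsn]
  exact hKU hs

theorem glue_comp_clamp (u : {u : ℕ → C(ℝ, X) // ResCompatible u}) (n : ℕ) :
    (glue u).comp (clamp (-(n : ℝ)) n) = u.1 n := by
  ext s
  have h : |clamp (-(n : ℝ)) n s| ≤ n :=
    abs_le.2 ⟨le_max_left _ _, max_le (neg_natCast_le n) (min_le_right _ _)⟩
  exact (u.2.glueFun_eq h).trans (u.2.eq_of_le le_rfl s).symm

theorem resCompatible_comp_clamp (w : C(ℝ, X)) :
    ResCompatible fun n => w.comp (clamp (-(n : ℝ)) n) := by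
  intro n s
  rw [trailRes_eq_clamp (neg_natCast_le n)]
  have h : |clamp (-(n : ℝ)) n s| ≤ ((n + 1 : ℕ) : ℝ) := by
    refine (abs_le.2 ⟨le_max_left _ _,
      max_le (neg_natCast_le n) (min_le_right _ _)⟩ : _ ≤ (n : ℝ)).trans ?_
    exact_mod_cast n.le_succ
  exact congrArg w (clamp_of_abs_le h).symm

theorem glue_resCompatible_comp_clamp (w : C(ℝ, X)) :
    glue ⟨_, resCompatible_comp_clamp w⟩ = w := by
  ext s
  exact congrArg w (clamp_of_abs_le (Nat.le_ceil _))

end Glue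

/-- For a proper metric space `X` with a consistent bicombing (with length control
function `f`), the map `w ↦ (res_{[−n,n]}(w))_{n∈ℕ}` is a homeomorphism from `FS(X,γ)`
onto the inverse limit of the system `A(X,γ,[−n,n])` with bonding maps
`res_{[−n,n]} : A(X,γ,[−(n+1),n+1]) → A(X,γ,[−n,n])`. -/
theorem fsset_homeo_inverse_limit {X : Type*} [MetricSpace X] [ProperSpace X]
    (B : ConstSpeedBicombing X) (hcons : BicombingConsistent B)
    (f : ℝ → ℝ) (hfc : ContinuousOn f (Set.Ici 0)) (hf0 : f 0 = 0)
    (hfnn : ∀ s, 0 ≤ s → 0 ≤ f s)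
    (hlen : ∀ x x' y y' : X, |B.len x y - B.len x' y'| ≤ f (dist x x' + dist y y')) :
    ∃ F : {w : C(ℝ, X) // w ∈ FSSet B} ≃ₜ
        {u : ℕ → C(ℝ, X) //
          (∀ n : ℕ, u n ∈ AIntSet B (-(n : ℝ)) (n : ℝ)) ∧
          ∀ (n : ℕ) (s : ℝ), u n s = trailRes (-(n : ℝ)) (n : ℝ) (⇑(u (n + 1))) s},
      ∀ (w : {w : C(ℝ, X) // w ∈ FSSet B}) (n : ℕ) (s : ℝ),
        (F w).1 n s = trailRes (-(n : ℝ)) (n : ℝ) (⇑w.1) s := by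
  have hB := ConstSpeedBicombing.continuous_len_of_control hfc hf0 hlen
  refine ⟨{
    toFun := fun w => ⟨fun n => w.1.comp (clamp (-(n : ℝ)) n), fun n =>
      comp_clamp_mem_AIntSet hcons hB (neg_natCast_le n) w.2, resCompatible_comp_clamp w.1⟩
    invFun := fun u => ⟨glue ⟨u.1, u.2.2⟩, mem_closure_of_tendsto (tendsto_glue ⟨u.1, u.2.2⟩)
      (Filter.Eventually.of_forall fun n => (u.2.1 n).1)⟩
    left_inv := fun w => Subtype.ext (glue_resCompatible_comp_clamp w.1)
    right_inv := fun u => Subtype.ext (funext (glue_comp_clamp ⟨u.1, u.2.2⟩))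
    continuous_toFun := Continuous.subtype_mk (continuous_pi fun n =>
      (ContinuousMap.continuous_precomp _).comp continuous_subtype_val) _
    continuous_invFun := Continuous.subtype_mk (continuous_glue.comp
      (continuous_subtype_val.subtype_mk _)) _ }, fun w n s => ?_⟩
  exact (trailRes_eq_clamp (neg_natCast_le n) _ s).symm
end FJ
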